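/- arXiv:1408.4000 — 2 statements merged into one kernel-verified Lean document; each statement's English description precedes it below -/
import Mathlib

section
/- Let A be a complex n×n matrix and let L be the linear operator on the space of n×n complex matrices defined by L(X) = A X + X Aᵀ. Then the set of eigenvalues of L equals the set of all pairwise sums {λ + μ : λ and μ are eigenvalues of A}. In particular, if every eigenvalue of A has negative real part, then every eigenvalue of L has negative real part. -/
open Matrix

theorem Matrix.mem_spectrum_iff_exists_mulVec_eq_smul {K ι : Type*} [Field K] [Fintype ι]
    [DecidableEq ι] {A : Matrix ι ι K} {a : K} :
    a ∈ spectrum K A ↔ ∃ v, v ≠ 0 ∧ A *ᵥ v = a • v := by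
  rw [← Matrix.spectrum_toLin', ← Module.End.hasEigenvalue_iff_mem_spectrum]
  constructor
  · intro h
    obtain ⟨v, hv⟩ := h.exists_hasEigenvector
    exact ⟨v, hv.2, by simpa using hv.apply_eq_smul⟩
  · rintro ⟨v, hv, h⟩
    exact Module.End.hasEigenvalue_of_hasEigenvector
      (Module.End.hasEigenvector_iff.2 ⟨Module.End.mem_eigenspace_iff.2 (by simpa using h), hv⟩)

theorem Matrix.mem_spectrum_of_mul_eq_smul {K ι κ : Type*} [Field K] [Fintype ι]
    [DecidableEq ι] {A : Matrix ι ι K} {X : Matrix ι κ K} {a : K} (hX : X ≠ 0)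
    (h : A * X = a • X) : a ∈ spectrum K A := by
  obtain ⟨j, hj⟩ : ∃ j, X.col j ≠ 0 := by
    by_contra! h0
    exact hX (Matrix.ext fun i j => congrFun (h0 j) i)
  refine mem_spectrum_iff_exists_mulVec_eq_smul.2 ⟨X.col j, hj, funext fun i => ?_⟩
  exact congrFun (congrFun h i) j

/-- Commuting endomorphisms of a finite-dimensional space over an algebraically closed field
share an eigenvector inside each eigenspace of the first one. -/
theorem Module.End.HasEigenvalue.exists_common_eigenvector {K V : Type*} [Field K]
    [IsAlgClosed K] [AddCommGroup V] [Module K V] [FiniteDimensional K V] {f g : Module.End K V}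
    {a : K} (ha : f.HasEigenvalue a) (hfg : Commute f g) :
    ∃ (b : K) (x : V), x ≠ 0 ∧ f x = a • x ∧ g x = b • x := by
  have hmaps : Set.MapsTo g (f.eigenspace a) (f.eigenspace a) :=
    Module.End.mapsTo_genEigenspace_of_comm hfg a 1
  have : Nontrivial (f.eigenspace a) := Submodule.nontrivial_iff_ne_bot.2 ha
  obtain ⟨b, hb⟩ := Module.End.exists_eigenvalue (g.restrict hmaps)
  obtain ⟨x, hx⟩ := hb.exists_hasEigenvector
  exact ⟨b, x, fun h => hx.2 (Subtype.ext h), Module.End.mem_eigenspace_iff.1 x.2,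
    congrArg Subtype.val hx.apply_eq_smul⟩

/-- The spectrum of the Lyapunov operator `L(X) = A X + X Aᵀ` on `n × n` complex matrices is the
set of pairwise sums of eigenvalues of `A`; in particular, if every eigenvalue of `A` has
negative real part, so does every eigenvalue of `L`. -/
theorem spectrum_lyapunov_operator {n : ℕ}
    (A : Matrix (Fin n) (Fin n) ℂ)
    (L : Module.End ℂ (Matrix (Fin n) (Fin n) ℂ))
    (hL : ∀ X : Matrix (Fin n) (Fin n) ℂ, L X = A * X + X * Aᵀ) :
    spectrum ℂ L = {z : ℂ | ∃ lam ∈ spectrum ℂ A, ∃ mu ∈ spectrum ℂ A, z = lam + mu} ∧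
    ((∀ mu ∈ spectrum ℂ A, mu.re < 0) → ∀ z ∈ spectrum ℂ L, z.re < 0) := by
  have hspec : spectrum ℂ L =
      {z : ℂ | ∃ lam ∈ spectrum ℂ A, ∃ mu ∈ spectrum ℂ A, z = lam + mu} := by
    ext z
    rw [← Module.End.hasEigenvalue_iff_mem_spectrum, Set.mem_ofPred_eq]
    constructor
    · intro hz
      have hcomm : Commute L (LinearMap.mulRight ℂ Aᵀ) :=
        LinearMap.ext fun X => by simp [hL, add_mul, mul_assoc]
      obtain ⟨b, X, hX, hLX, hXA⟩ := hz.exists_common_eigenvector hcomm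
      rw [LinearMap.mulRight_apply] at hXA
      rw [hL, hXA] at hLX
      refine ⟨z - b, mem_spectrum_of_mul_eq_smul hX ?_, b,
        mem_spectrum_of_mul_eq_smul (X := Xᵀ) (by simpa using hX) ?_, by ring⟩
      · rw [sub_smul, ← hLX, add_sub_cancel_right]
      · simpa using congrArg transpose hXA
    · rintro ⟨a, ha, b, hb, rfl⟩
      obtain ⟨v, hv, hAv⟩ := mem_spectrum_iff_exists_mulVec_eq_smul.1 ha
      obtain ⟨w, hw, hAw⟩ := mem_spectrum_iff_exists_mulVec_eq_smul.1 hb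
      refine Module.End.hasEigenvalue_of_hasEigenvector (x := vecMulVec v w)
        (Module.End.hasEigenvector_iff.2 ⟨Module.End.mem_eigenspace_iff.2 ?_, ?_⟩)
      · rw [hL, mul_vecMulVec, vecMulVec_mul, vecMul_transpose, hAv, hAw, smul_vecMulVec,
          vecMulVec_smul, add_smul]
      · simp [vecMulVec_eq_zero, hv, hw]
  refine ⟨hspec, fun hA z hz => ?_⟩
  rw [hspec] at hz
  obtain ⟨a, ha, b, hb, rfl⟩ := hz
  exact add_neg (hA a ha) (hA b hb)
end

section
/- Fix μ > 0 and σ > 0, and consider the fold (saddle-node) normal form ṗ = μ − p². Then p* = √μ is an equilibrium, the linearization at p* has the eigenvalue a = −2√μ < 0 (so p* is linearly asymptotically stable), and the unique solution V of the associated scalar Lyapunov equation 2 a V + σ² = 0 is V = σ²/(4√μ). In particular V · μ^{1/2} = σ²/4 is independent of μ, so the stationary variance V diverges proportionally to μ^{−1/2} as μ ↘ 0, i.e. as the fold bifurcation point is approached the fluctuations obey a square-root scaling law with exponent α = 1/2. -/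
open Real

/-- Square-root scaling law at a fold: for the fold normal form `ṗ = μ - p²` with `μ > 0`,
`p* = √μ` is an equilibrium, the linearization there has eigenvalue `a = -2√μ < 0`, the unique
solution of the scalar Lyapunov equation `2 a V + σ² = 0` is `V = σ²/(4√μ)`, and
`V · μ^{1/2} = σ²/4` is independent of `μ`; moreover the stationary variance diverges like
`μ^{-1/2}` as `μ ↘ 0` (exponent `α = 1/2`). -/
theorem fold_normal_form_variance_scaling (μ σ : ℝ) (hμ : 0 < μ) (hσ : 0 < σ) :
    (μ - Real.sqrt μ ^ 2 = 0) ∧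
    (deriv (fun p : ℝ => μ - p ^ 2) (Real.sqrt μ) = -2 * Real.sqrt μ) ∧
    (-2 * Real.sqrt μ < 0) ∧
    (∀ V : ℝ, 2 * (-2 * Real.sqrt μ) * V + σ ^ 2 = 0 ↔ V = σ ^ 2 / (4 * Real.sqrt μ)) ∧
    (σ ^ 2 / (4 * Real.sqrt μ) * μ ^ ((1 : ℝ) / 2) = σ ^ 2 / 4) ∧
    Filter.Tendsto (fun μ' : ℝ => σ ^ 2 / (4 * Real.sqrt μ'))
      (nhdsWithin 0 (Set.Ioi 0)) Filter.atTop := by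
  have hs : 0 < Real.sqrt μ := Real.sqrt_pos.mpr hμ
  refine ⟨by rw [Real.sq_sqrt hμ.le, sub_self], ?_, by linarith, fun V ↦ ?_, ?_, ?_⟩
  · simp
  · rw [eq_div_iff (by positivity)]
    constructor <;> intro h <;> linarith
  · rw [← Real.sqrt_eq_rpow]
    field_simp
  · have hlim : Filter.Tendsto (fun x : ℝ ↦ 4 * Real.sqrt x)
        (nhdsWithin 0 (Set.Ioi 0)) (nhdsWithin 0 (Set.Ioi 0)) := by
      refine tendsto_nhdsWithin_iff.mpr ⟨?_, ?_⟩
      · have hcont : Continuous fun x : ℝ ↦ 4 * Real.sqrt x := by fun_prop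
        simpa using (hcont.tendsto 0).mono_left nhdsWithin_le_nhds
      · filter_upwards [self_mem_nhdsWithin] with x hx
        exact mul_pos four_pos (Real.sqrt_pos.mpr hx)
    simpa only [div_eq_mul_inv, Function.comp_def] using
      (tendsto_inv_nhdsGT_zero.comp hlim).const_mul_atTop (pow_pos hσ 2)
end
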